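/- For all integers m, n ≥ 2, the Cayley digraph Cay(ℤ_m × ℤ_n; e₁, e₂) (which is isomorphic to the Cartesian product of a directed cycle of length m and a directed cycle of length n) has two arc-disjoint hamiltonian paths. -/

import Mathlib

/-- The arc set of a path `v : Fin N → G`: the pairs `(v i, v (i+1))`. -/
def ArcSet {G : Type*} (N : ℕ) (v : Fin N → G) : Set (G × G) :=
  {p | ∃ (i : ℕ) (h : i + 1 < N), p = (v ⟨i, Nat.lt_of_succ_lt h⟩, v ⟨i + 1, h⟩)}

/-- `v : Fin N → G` is a hamiltonian path of the Cayley digraph `Cay(G; a, b)`: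
a bijection onto the vertex set `G` each of whose steps is by `a` or by `b`. -/
def IsHamPath {G : Type*} [AddCommGroup G] (a b : G) (N : ℕ) (v : Fin N → G) : Prop :=
  Function.Bijective v ∧
    ∀ (i : ℕ) (h : i + 1 < N),
      v ⟨i + 1, h⟩ - v ⟨i, Nat.lt_of_succ_lt h⟩ ∈ ({a, b} : Set G)

/-- `x` lies on the forward orbit of `s` under `f`. -/
def Reaches {G : Type*} (f : G → G) (s x : G) : Prop := ∃ i : ℕ, f^[i] s = x

namespace Reaches

variable {G : Type*} {f : G → G} {s x : G}

theorem refl (f : G → G) (s : G) : Reaches f s s := ⟨0, rfl⟩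

theorem step (h : Reaches f s x) : Reaches f s (f x) := by
  obtain ⟨i, rfl⟩ := h
  exact ⟨i + 1, Function.iterate_succ_apply' f i s⟩

theorem chain (y : ℤ → G) {l h : ℤ} (hlh : l ≤ h) (hl : Reaches f s (y l))
    (hy : ∀ t, l ≤ t → t < h → f (y t) = y (t + 1)) : Reaches f s (y h) := by
  induction h, hlh using Int.leInduction with
  | base => exact hl
  | succ k hk ih =>
    have := (ih fun t h1 h2 => hy t h1 (by lia)).step
    rwa [hy k hk (by lia)] at this

end Reaches

theorem forall_reaches_of_shift {G : Type*} [AddCommGroup G] {f : G → G} {s c : G} (S : Set G)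
    (hf : ∀ x ∉ S, f x = x + c) (hS : ∀ x ∈ S, Reaches f s (x + c))
    (hex : ∀ x, ∃ t : ℕ, x - (t + 1) • c ∈ S) (x : G) : Reaches f s x := by
  obtain ⟨t, ht⟩ := hex x
  induction t generalizing x with
  | zero => simpa using hS _ ht
  | succ t ih =>
    by_cases hx : x - c ∈ S
    · simpa using hS _ hx
    · have h := (ih (x - c) (by convert ht using 1; rw [succ_nsmul c (t + 1)]; abel)).step
      rwa [hf _ hx, sub_add_cancel] at h

/-- If every point lies on the orbit of `s`, the first `N` points of the orbit are distinct. -/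
theorem iterate_injOn_of_forall_reaches {G : Type*} [Fintype G] {f : G → G} {s : G}
    (h : ∀ x, Reaches f s x) {i j : ℕ} (hij : i < j) (hj : j < Fintype.card G) :
    f^[i] s ≠ f^[j] s := by
  intro he
  have key : ∀ k, ∃ l < j, f^[l] s = f^[k] s := by
    intro k
    induction k using Nat.strong_induction_on with
    | _ k ih =>
      by_cases hk : k < j
      · exact ⟨k, hk, rfl⟩
      · obtain ⟨l, hl, hl'⟩ := ih (k - j + i) (by lia)
        refine ⟨l, hl, hl'.trans ?_⟩
        rw [Function.iterate_add_apply, he, ← Function.iterate_add_apply]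
        congr 1
        lia
  have hsurj : Function.Surjective (fun l : Fin j => f^[l] s) := by
    intro x
    obtain ⟨k, rfl⟩ := h x
    obtain ⟨l, hl, hl'⟩ := key k
    exact ⟨⟨l, hl⟩, hl'⟩
  have := Fintype.card_le_of_surjective _ hsurj
  simp at this
  lia

open Classical in
/-- The successor function which moves by `a` on `A`, sends `T` to `s`, and moves by `b`
elsewhere. -/
noncomputable def successor {G : Type*} [AddCommGroup G] (a b : G) (A : Set G) (T s x : G) : G :=
  if x ∈ A then x + a else if x = T then s else x + b

section successor

variable {G : Type*} [AddCommGroup G] {a b : G} {A A' : Set G} {T T' s s' x : G}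

theorem successor_of_mem (hx : x ∈ A) : successor a b A T s x = x + a := by
  simp [successor, hx]

theorem successor_terminal (hT : T ∉ A) : successor a b A T s T = s := by
  simp [successor, hT]

theorem successor_of_notMem (hx : x ∉ A) (hT : x ≠ T) : successor a b A T s x = x + b := by
  simp [successor, hx, hT]

theorem isHamPath_of_reaches [Fintype G] {N : ℕ} (hN : Fintype.card G = N) (hT : T ∉ A)
    (h : ∀ x, Reaches (successor a b A T s) s x) :
    IsHamPath a b N (fun i => (successor a b A T s)^[i] s) ∧
      ∀ p ∈ ArcSet N (fun i => (successor a b A T s)^[i] s),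
        (p.1 ∈ A ∧ p.2 = p.1 + a) ∨ (p.1 ∉ A ∧ p.1 ≠ T ∧ p.2 = p.1 + b) := by
  subst hN
  set f := successor a b A T s with hf
  have hstep : ∀ i : ℕ, i + 1 < Fintype.card G →
      (f^[i] s ∈ A ∧ f^[i + 1] s = f^[i] s + a) ∨
        (f^[i] s ∉ A ∧ f^[i] s ≠ T ∧ f^[i + 1] s = f^[i] s + b) := by
    intro i hi
    rw [Function.iterate_succ_apply']
    by_cases hA : f^[i] s ∈ A
    · exact Or.inl ⟨hA, successor_of_mem hA⟩
    · have hne : f^[i] s ≠ T := by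
        intro he
        apply iterate_injOn_of_forall_reaches h (Nat.succ_pos i) hi
        rw [Function.iterate_succ_apply', he, hf, successor_terminal hT]
        rfl
      exact Or.inr ⟨hA, hne, successor_of_notMem hA hne⟩
  refine ⟨⟨?_, fun i hi => ?_⟩, ?_⟩
  · rw [Fintype.bijective_iff_injective_and_card]
    refine ⟨fun i j hij => ?_, by simp⟩
    rcases lt_trichotomy i j with hlt | heq | hlt
    · exact (iterate_injOn_of_forall_reaches h hlt j.2 hij).elim
    · exact heq
    · exact (iterate_injOn_of_forall_reaches h hlt i.2 hij.symm).elim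
  · rcases hstep i hi with ⟨-, h2⟩ | ⟨-, -, h2⟩
    · left
      exact sub_eq_iff_eq_add'.2 h2
    · right
      exact sub_eq_iff_eq_add'.2 h2
  · rintro p ⟨i, hi, rfl⟩
    exact hstep i hi

theorem IsHamPath.symm {N : ℕ} {v : Fin N → G} (h : IsHamPath a b N v) : IsHamPath b a N v := by
  refine ⟨h.1, fun i hi => ?_⟩
  rw [Set.pair_comm]
  exact h.2 i hi

theorem exists_disjoint_hamPaths [Fintype G] {N : ℕ} (hN : Fintype.card G = N) (hab : a ≠ b)
    (hT : T ∉ A) (hT' : T' ∉ A') (hA : ∀ x ∈ A, x ∈ A' ∨ x = T') (hA' : ∀ x ∈ A', x ∈ A ∨ x = T)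
    (h : ∀ x, Reaches (successor a b A T s) s x)
    (h' : ∀ x, Reaches (successor b a A' T' s') s' x) :
    ∃ v v' : Fin N → G, IsHamPath a b N v ∧ IsHamPath a b N v' ∧
      Disjoint (ArcSet N v) (ArcSet N v') := by
  obtain ⟨h1, h2⟩ := isHamPath_of_reaches hN hT h
  obtain ⟨h1', h2'⟩ := isHamPath_of_reaches hN hT' h'
  refine ⟨_, _, h1, h1'.symm, Set.disjoint_left.2 fun p hp hp' => ?_⟩
  rcases h2 p hp with ⟨hm, he⟩ | ⟨hm, hne, he⟩ <;>
    rcases h2' p hp' with ⟨hm', he'⟩ | ⟨hm', hne', he'⟩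
  · exact hab (add_left_cancel (he.symm.trans he'))
  · exact (hA _ hm).elim hm' hne'
  · exact (hA' _ hm').elim hm hne
  · exact hab (add_left_cancel (he'.symm.trans he))

end successor

/-- An orbit of the rotation by `-μ` on `ℤ/L`, followed from `0` until it reaches `μ`, is
everything when `μ` is coprime to `L`. -/
theorem forall_of_rotation {L μ : ℕ} (hμ : μ < L) (hc : Nat.Coprime μ L) {P : ℕ → Prop}
    (h0 : P 0) (hlt : ∀ x < μ, P x → P (x + L - μ))
    (hgt : ∀ x, μ < x → x < L → P x → P (x - μ)) : ∀ x < L, P x := by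
  have hc' : Nat.Coprime (L - μ) L := (Nat.coprime_self_sub_left hμ.le).2 hc
  have key : ∀ t < L, P (t * (L - μ) % L) := by
    intro t
    induction t with
    | zero => intro _; simpa using h0
    | succ t ih =>
      intro ht
      have hx := ih (by lia)
      have hxL : t * (L - μ) % L < L := Nat.mod_lt _ (by lia)
      have he : (t + 1) * (L - μ) % L = (t * (L - μ) % L + (L - μ)) % L := by
        rw [add_mul, one_mul, Nat.mod_add_mod]
      set x := t * (L - μ) % L
      rcases lt_trichotomy x μ with hlt' | heq | hgt'
      · rw [he, Nat.mod_eq_of_lt (by lia), show x + (L - μ) = x + L - μ by lia]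
        exact hlt x hlt' hx
      · rw [heq, show μ + (L - μ) = L by lia, Nat.mod_self] at he
        have := Nat.le_of_dvd (by lia) (hc'.symm.dvd_of_dvd_mul_right (Nat.dvd_of_mod_eq_zero he))
        lia
      · rw [he, show x + (L - μ) = x - μ + L by lia, Nat.add_mod_right, Nat.mod_eq_of_lt (by lia)]
        exact hgt x hgt' hxL hx
  intro x hx
  by_cases hL : 1 < L
  · obtain ⟨c, -, hc⟩ := Nat.exists_mul_mod_eq_one_of_coprime hc' hL
    have := key (c * x % L) (Nat.mod_lt _ (by lia))
    rwa [Nat.mod_mul_mod, show c * x * (L - μ) = (L - μ) * c * x by ring, Nat.mul_mod, hc,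
      one_mul, Nat.mod_mod, Nat.mod_eq_of_lt hx] at this
  · obtain rfl : x = 0 := by lia
    exact h0

/-- The point `j (e₁ - e₂) + (t - 1) e₂`; the second index counts steps after the coset `t = 0`
of the subgroup generated by `e₁ - e₂`. -/
def diagPt (m n : ℕ) (j t : ℤ) : ZMod m × ZMod n := ((j : ZMod m), ((t - 1 - j : ℤ) : ZMod n))

section diagPt

variable {m n : ℕ}

theorem diagPt_add_fst (j t : ℤ) : diagPt m n j t + (1, 0) = diagPt m n (j + 1) (t + 1) := by
  ext <;> simp [diagPt]
  ring

theorem diagPt_add_snd (j t : ℤ) : diagPt m n j t + (0, 1) = diagPt m n j (t + 1) := by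
  ext <;> simp [diagPt]
  ring

theorem diagPt_eq_iff {j t j' t' : ℤ} :
    diagPt m n j t = diagPt m n j' t' ↔ (m : ℤ) ∣ j' - j ∧ (n : ℤ) ∣ t' - j' - (t - j) := by
  rw [diagPt, diagPt, Prod.mk.injEq, ZMod.intCast_eq_intCast_iff_dvd_sub,
    ZMod.intCast_eq_intCast_iff_dvd_sub]
  ring_nf

end diagPt

theorem exists_sub_nsmul_fst {m n : ℕ} [NeZero m] [NeZero n] (x : ZMod m × ZMod n) :
    ∃ j t : ℕ, j < n ∧ x - (t + 1) • (1, 0) = diagPt m n j 0 := by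
  obtain ⟨x₁, x₂⟩ := x
  refine ⟨(-1 - x₂).val, (x₁ - 1 - (-1 - x₂).val).val, ZMod.val_lt _, ?_⟩
  ext <;> simp [diagPt]
  ring

theorem exists_sub_nsmul_snd {m n : ℕ} [NeZero m] [NeZero n] (x : ZMod m × ZMod n) :
    ∃ j t : ℕ, j < m ∧ x - (t + 1) • (0, 1) = diagPt m n j 0 := by
  obtain ⟨x₁, x₂⟩ := x
  refine ⟨x₁.val, (x₂ + x₁.val).val, ZMod.val_lt _, ?_⟩
  ext <;> simp [diagPt]
  ring

/-- The points `diagPt m n i 0` with `lo ≤ i < hi`. -/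
def diagSegment (m n : ℕ) (lo hi : ℤ) : Set (ZMod m × ZMod n) :=
  (fun i => diagPt m n i 0) '' Set.Ico lo hi

theorem eq_zero_of_dvd_of_lt {m r : ℤ} (h : m ∣ r) (h1 : -m < r) (h2 : r < m) : r = 0 :=
  Int.eq_zero_of_abs_lt_dvd h (abs_lt.2 ⟨h1, h2⟩)

section NotDvd

variable {m n : ℕ} {q w K : ℤ}

/-- Where a vertical run meets the coset `t = 0`. -/
theorem diagPt_snd_meets (hw : 0 < w) (hwm : w < m) (hq : 1 ≤ q) (hn : (n : ℤ) = q * m + w)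
    {i j t : ℤ} (h : diagPt m n j t = diagPt m n i 0) (hij : j - i < 2 * n) (hji : i - j < 2 * n)
    (ht : 0 < t) (htm : t < m) :
    (t = w ∧ i = j + q * m) ∨ (t = m - w ∧ i = j - (q * m + m)) ∨
      (t = 2 * w ∧ i = j + 2 * (q * m)) ∨ (t = 2 * w - m ∧ i = j + 2 * (q * m) + m) := by
  rw [diagPt_eq_iff] at h
  obtain ⟨⟨u, hu⟩, ⟨v, hv⟩⟩ := h
  have hqm : (m : ℤ) ≤ q * m := by nlinarith
  have h1 : -3 < v := by
    by_contra! h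
    nlinarith
  have h2 : v < 3 := by
    by_contra! h
    nlinarith
  have h3 : ∀ e : ℤ, (m : ℤ) ∣ t + w * v + m * e := fun e =>
    ⟨e - (u + q * v), by rw [hn] at hv; linarith⟩
  have h4 : ∀ e : ℤ, -m < t + w * v + m * e → t + w * v + m * e < m → t + w * v + m * e = 0 :=
    fun e => eq_zero_of_dvd_of_lt (h3 e)
  generalize q * (m : ℤ) = X at *
  have a0 := h4 0
  have a1 := h4 1
  have a2 := h4 (-1)
  interval_cases v <;> lia

theorem diagPt_fst_meets (hw : 0 < w) (hwm : w < m) (hn : (n : ℤ) = q * m + w)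
    {i j t : ℤ} (h : diagPt m n (j + t) t = diagPt m n i 0) (hij : j - i < 2 * n)
    (hji : i - j < 2 * n) (ht : 0 < t) (htm : t < m) :
    (t = w ∧ i = j + n) ∨ (t = m - w ∧ i = j - n) := by
  rw [diagPt_eq_iff] at h
  obtain ⟨⟨u, hu⟩, ⟨v, hv⟩⟩ := h
  have h1 : -2 < v := by
    by_contra! h
    nlinarith
  have h2 : v < 2 := by
    by_contra! h
    nlinarith
  have h3 : ∀ e : ℤ, (m : ℤ) ∣ t + w * v + m * e := fun e =>
    ⟨e - (u + q * v), by rw [hn] at hv; linarith⟩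
  have h4 : ∀ e : ℤ, -m < t + w * v + m * e → t + w * v + m * e < m → t + w * v + m * e = 0 :=
    fun e => eq_zero_of_dvd_of_lt (h3 e)
  have a0 := h4 0
  have a1 := h4 1
  have a2 := h4 (-1)
  interval_cases v <;> lia

/-- Distinctness of the points `diagPt m n i 0` over an index window of length `2 * n`. -/
theorem diagPt_zero_injOn (hw : 0 < w) (hwm : w < m) (hn : (n : ℤ) = q * m + w) {i j : ℤ}
    (h : diagPt m n j 0 = diagPt m n i 0) (hij : j - i < 2 * n) (hji : i - j < 2 * n) :
    i = j := by
  rw [diagPt_eq_iff] at h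
  obtain ⟨⟨u, hu⟩, ⟨v, hv⟩⟩ := h
  have h1 : -2 < v := by
    by_contra! h
    nlinarith
  have h2 : v < 2 := by
    by_contra! h
    nlinarith
  have h3 : (m : ℤ) ∣ w * v := ⟨-(u + q * v), by rw [hn] at hv; linarith⟩
  have h4 := eq_zero_of_dvd_of_lt h3
  interval_cases v <;> lia

theorem notMem_diagSegment (hw : 0 < w) (hwm : w < m) (hn : (n : ℤ) = q * m + w) {lo hi j : ℤ}
    (h2 : j < lo ∨ hi ≤ j) (h3 : hi - 2 * n ≤ j) (h4 : j < lo + 2 * n) :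
    diagPt m n j 0 ∉ diagSegment m n lo hi := by
  rintro ⟨i, hi, h⟩
  have := diagPt_zero_injOn hw hwm hn h
  simp only [Set.mem_Ico] at hi
  lia

theorem diagPt_mem_diagSegment {lo hi j : ℤ} (h1 : lo ≤ j) (h2 : j < hi) :
    diagPt m n j 0 ∈ diagSegment m n lo hi := ⟨j, ⟨h1, h2⟩, rfl⟩

theorem reaches_snd {s : ZMod m × ZMod n} {j h i : ℤ}
    (hr : Reaches (successor (1, 0) (0, 1) (diagSegment m n 0 K) (diagPt m n K 0) s) s
      (diagPt m n j 1))
    (hh : 1 ≤ h) (hi : 0 ≤ i) (hiK : i < K) (he : diagPt m n j h = diagPt m n i 0)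
    (hno : ∀ t i, 1 ≤ t → t < h → 0 ≤ i → i ≤ K → diagPt m n j t ≠ diagPt m n i 0) :
    Reaches (successor (1, 0) (0, 1) (diagSegment m n 0 K) (diagPt m n K 0) s) s
      (diagPt m n (i + 1) 1) := by
  have h1 := Reaches.chain (fun t => diagPt m n j t) hh hr fun t ht1 ht2 => by
    rw [successor_of_notMem, diagPt_add_snd]
    · rintro ⟨i, hi, h⟩
      exact hno t i ht1 ht2 hi.1 hi.2.le h.symm
    · exact hno t K ht1 ht2 (by lia) le_rfl
  have h2 := h1.step
  rwa [he, successor_of_mem (diagPt_mem_diagSegment hi hiK), diagPt_add_fst] at h2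

/-- The first path: along the diagonal segment move by `e₁`, elsewhere by `e₂`. -/
theorem reaches_of_rotation {g μ Q' : ℕ} (hw : 0 < w) (hwm : w < m) (hq : 1 ≤ q)
    (hn : (n : ℤ) = q * m + w) (hg : 0 < g) (hμ : 0 < μ) (hm : m = g * μ + 1)
    (hQ : q + 1 = g * Q') (hc : Nat.Coprime μ (Q' * m)) (hK : K = (q + 1) * m + g - 2)
    (x : ZMod m × ZMod n) :
    Reaches (successor (1, 0) (0, 1) (diagSegment m n 0 K) (diagPt m n K 0) (diagPt m n 0 1))
      (diagPt m n 0 1) x := by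
  have hqm : (m : ℤ) ≤ q * m := by nlinarith
  have hgm : g < m := by nlinarith
  have hK2 : K < 2 * n := by
    have : (g : ℤ) ≤ q + 1 := Int.le_of_dvd (by lia) ⟨_, hQ⟩
    nlinarith
  have hmeets {i j t : ℤ} := @diagPt_snd_meets m n q w hw hwm hq hn i j t
  have hμQ : (g * (Q' * m) : ℤ) = q * m + m := by rw [← mul_assoc, ← hQ]; ring
  have hgμ : (g * μ : ℤ) = m - 1 := by rw [hm]; push_cast; ring
  set R : ℤ → Prop := fun j => Reaches
    (successor (1, 0) (0, 1) (diagSegment m n 0 K) (diagPt m n K 0) (diagPt m n 0 1))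
    (diagPt m n 0 1) (diagPt m n j 1) with hR
  rw [add_mul, one_mul] at hK
  have hlow : ∀ j : ℤ, 0 ≤ j → j ≤ m + g - 2 → j + q * m < K → R j → R (j + q * m + 1) := by
    intro j h0 h1 h2 hj
    refine reaches_snd (h := w) hj (by lia) (by lia) h2 ?_ fun t i ht1 ht2 hi hiK he => ?_
    · rw [diagPt_eq_iff]
      exact ⟨⟨q, by ring⟩, -1, by rw [hn]; ring⟩
    · have := hmeets he (by lia) (by lia) (by lia) (by lia)
      generalize q * (m : ℤ) = X at *
      lia
  have hhigh : ∀ j, q * m + m ≤ j → j ≤ K → R j → R (j - (q * m + m) + 1) := by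
    intro j h0 h1 hj
    refine reaches_snd (h := m - w) hj (by lia) (by lia) (by lia) ?_
      fun t i ht1 ht2 hi hiK he => ?_
    · rw [diagPt_eq_iff]
      exact ⟨⟨-q - 1, by ring⟩, 1, by rw [hn]; ring⟩
    · have := hmeets he (by lia) (by lia) (by lia) (by lia)
      generalize q * (m : ℤ) = X at *
      lia
  have hmid : ∀ j : ℤ, m + g - 1 ≤ j → j < q * m + m → R j → R (j - m + 1) := by
    intro j h0 h1 hj
    refine reaches_snd (h := m) hj (by lia) (by lia) (by lia) ?_
      fun t i ht1 ht2 hi hiK he => ?_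
    · rw [diagPt_eq_iff]
      exact ⟨⟨-1, by ring⟩, 0, by ring⟩
    · have := hmeets he (by lia) (by lia) (by lia) (by lia)
      generalize q * (m : ℤ) = X at *
      lia
  have hμL : μ < Q' * m := by
    have : 0 < Q' := by
      rcases Nat.eq_zero_or_pos Q' with rfl | h
      · simp at hQ; lia
      · exact h
    nlinarith
  have hclass : ∀ ρ : ℕ, ρ < g → R ρ → ∀ x < Q' * m, R (g * x + ρ) := by
    intro ρ hρ h0
    refine forall_of_rotation hμL hc (P := fun x => R (g * x + ρ)) (by simpa using h0)
      (fun x hx hP => ?_) (fun x hx hxL hP => ?_)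
    · have h1 : (g * x + g : ℤ) ≤ g * μ := by nlinarith
      have := hlow _ (by positivity) (by lia) (by lia) hP
      rw [Nat.cast_sub (by lia)]
      push_cast
      convert this using 1
      linear_combination hμQ - hgμ
    · have h1 : (g * μ + g : ℤ) ≤ g * x := by nlinarith
      have h2 : (g * x + g : ℤ) ≤ g * (Q' * m) := by nlinarith [Nat.cast_lt (α := ℤ).2 hxL]
      have := hmid _ (by lia) (by lia) hP
      rw [Nat.cast_sub (by lia)]
      convert this using 1
      linear_combination - hgμ
  have hwrap : ∀ ρ : ℕ, ρ + 1 < g → R ρ → R (q * m + m + ρ) := by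
    intro ρ hρ h0
    have := hlow _ (by positivity) (by lia) (by lia) (hclass ρ (by lia) h0 μ hμL)
    convert this using 1
    linear_combination - hgμ
  have hstart : ∀ ρ : ℕ, ρ < g → R ρ := by
    intro ρ
    induction ρ with
    | zero => exact fun _ => .refl _ _
    | succ ρ ih =>
      intro hρ
      have := hhigh _ (by lia) (by lia) (hwrap ρ hρ (ih (by lia)))
      convert this using 1
      push_cast
      ring
  have hall : ∀ j : ℤ, 0 ≤ j → j ≤ K → R j := by
    intro j h0 hjK
    lift j to ℕ using h0
    by_cases hj : j < g * (Q' * m)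
    · have := hclass (j % g) (Nat.mod_lt _ hg) (hstart _ (Nat.mod_lt _ hg)) (j / g)
        (Nat.div_lt_of_lt_mul hj)
      convert this using 1
      exact_mod_cast (Nat.div_add_mod j g).symm
    · have hj' : ((j - g * (Q' * m) : ℕ) : ℤ) = j - (q * m + m) := by
        rw [Nat.cast_sub (by lia)]; push_cast; rw [hμQ]
      have := hwrap (j - g * (Q' * m)) (by lia) (hstart _ (by lia))
      rw [hj'] at this
      convert this using 1
      ring
  have : NeZero m := ⟨by lia⟩
  have : NeZero n := ⟨by lia⟩
  refine forall_reaches_of_shift (c := (0, 1)) (diagSegment m n 0 (K + 1))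
    (fun x hx => successor_of_notMem (fun h => hx ?_) fun h => hx ?_) ?_ (fun x => ?_) x
  · obtain ⟨i, hi, rfl⟩ := h
    exact diagPt_mem_diagSegment hi.1 (by have := hi.2; lia)
  · rw [h]
    exact diagPt_mem_diagSegment (by lia) (by lia)
  · rintro _ ⟨i, hi, rfl⟩
    rw [diagPt_add_snd]
    exact hall i hi.1 (by have := hi.2; lia)
  · obtain ⟨j, t, hj, he⟩ := exists_sub_nsmul_snd x
    exact ⟨t, he ▸ diagPt_mem_diagSegment (by lia) (by lia)⟩

theorem forall_of_descent {R : ℤ → Prop} {n D : ℤ} (hD : Odd D) (h1 : 1 ≤ D) (hn : D < n)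
    (h0 : R (n + D)) (hhigh : ∀ l, n < l → l ≤ n + D → R l → R (l - 1 - n))
    (hlow : ∀ l, 0 ≤ l → l ≤ D → R l → R (l - 1 + n))
    (hmid : ∀ l, D < l → l < n → R l → R (l - 1)) (l : ℤ) (h0l : 0 ≤ l) (hl : l ≤ n + D) :
    R l := by
  obtain ⟨d, rfl⟩ := hD
  have hdesc : ∀ (c : ℤ) (k : ℕ), n ≤ c - 2 * k → c ≤ n + (2 * d + 1) → R c → R (c - 2 * k) := by
    intro c k
    induction k with
    | zero => intro _ _ h; simpa using h
    | succ k ih =>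
      intro h2 h3 h
      have := hlow _ (by lia) (by lia) (hhigh _ (by lia) (by lia) (ih (by lia) h3 h))
      convert this using 1
      lia
  have hodd : ∀ k : ℕ, k ≤ d → R (n + 2 * (d - k) + 1) := by
    intro k hk
    convert hdesc _ k (by lia) le_rfl h0 using 1
    lia
  have hzero : R 0 := by
    convert hhigh _ (by lia) (by lia) (hodd d.toNat (by lia)) using 1
    lia
  have hmiddle : ∀ k : ℕ, k ≤ n - 1 - (2 * d + 1) → R (n - 1 - k) := by
    intro k
    induction k with
    | zero =>
      intro _
      convert hlow _ le_rfl (by lia) hzero using 1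
      lia
    | succ k ih =>
      intro hk
      convert hmid _ (by lia) (by lia) (ih (by lia)) using 1
      lia
  have heven : ∀ k : ℕ, k ≤ d → R (n + 2 * (d - k)) := by
    intro k hk
    have h := hlow _ (by lia) (by lia) (hmiddle (n - 1 - (2 * d + 1)).toNat (by lia))
    convert hdesc _ k (by lia) (by lia) h using 1
    lia
  have htop : ∀ l, n ≤ l → l ≤ n + (2 * d + 1) → R l := by
    intro l h1 h2
    rcases Int.even_or_odd' (l - n) with ⟨c, hc | hc⟩
    · convert heven (d - c).toNat (by lia) using 1
      lia
    · convert hodd (d - c).toNat (by lia) using 1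
      lia
  rcases lt_or_ge l n with h | h
  · rcases lt_or_ge l (2 * d + 1) with h' | h'
    · convert hhigh _ (by lia) (by lia) (htop (l + 1 + n) (by lia) (by lia)) using 1
      lia
    · convert hmiddle (n - 1 - l).toNat (by lia) using 1
      lia
  · exact htop l h hl

theorem reaches_fst {s : ZMod m × ZMod n} {l h i : ℤ}
    (hr : Reaches (successor (0, 1) (1, 0) (diagSegment m n 0 K) (diagPt m n (-1) 0) s) s
      (diagPt m n l 1))
    (hh : 1 ≤ h) (hi : 0 ≤ i) (hiK : i < K) (he : diagPt m n (l - 1 + h) h = diagPt m n i 0)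
    (hno : ∀ t i, 1 ≤ t → t < h → -1 ≤ i → i < K → diagPt m n (l - 1 + t) t ≠ diagPt m n i 0) :
    Reaches (successor (0, 1) (1, 0) (diagSegment m n 0 K) (diagPt m n (-1) 0) s) s
      (diagPt m n i 1) := by
  have h1 := Reaches.chain (fun t => diagPt m n (l - 1 + t) t) hh (by simpa using hr)
    fun t ht1 ht2 => by
      rw [successor_of_notMem, diagPt_add_fst, add_assoc]
      · rintro ⟨i, hi, h⟩
        exact hno t i ht1 ht2 (by have := hi.1; lia) hi.2 h.symm
      · exact hno t (-1) ht1 ht2 le_rfl (by lia)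
  have h2 := h1.step
  rwa [he, successor_of_mem (diagPt_mem_diagSegment hi hiK), diagPt_add_snd] at h2

/-- The second path: along the diagonal segment move by `e₂`, elsewhere by `e₁`. -/
theorem reaches_of_descent {D : ℤ} (hw : 0 < w) (hwm : w < m)
    (hn : (n : ℤ) = q * m + w) (hD : Odd D) (hD0 : 1 ≤ D) (hDn : D < n) (x : ZMod m × ZMod n) :
    Reaches (successor (0, 1) (1, 0) (diagSegment m n 0 (n + D)) (diagPt m n (-1) 0)
      (diagPt m n (n + D) 1)) (diagPt m n (n + D) 1) x := by
  have hmeets {i j t : ℤ} := @diagPt_fst_meets m n q w hw hwm hn i j t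
  have hall := forall_of_descent (R := fun l => Reaches (successor (0, 1) (1, 0)
    (diagSegment m n 0 (n + D)) (diagPt m n (-1) 0) (diagPt m n (n + D) 1))
    (diagPt m n (n + D) 1) (diagPt m n l 1)) hD hD0 hDn (.refl _ _)
    (fun l h1 h2 hl => by
      refine reaches_fst (h := m - w) hl (by lia) (by lia) (by lia) ?_
        fun t i ht1 ht2 hi hiK he => ?_
      · rw [diagPt_eq_iff]
        exact ⟨⟨-q - 1, by rw [hn]; ring⟩, 1, by ring⟩
      · have := hmeets he (by lia) (by lia) (by lia) (by lia)
        lia)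
    (fun l h1 h2 hl => by
      refine reaches_fst (h := w) hl (by lia) (by lia) (by lia) ?_
        fun t i ht1 ht2 hi hiK he => ?_
      · rw [diagPt_eq_iff]
        exact ⟨⟨q, by rw [hn]; ring⟩, -1, by ring⟩
      · have := hmeets he (by lia) (by lia) (by lia) (by lia)
        lia)
    (fun l h1 h2 hl => by
      refine reaches_fst (h := m) hl (by lia) (by lia) (by lia) ?_
        fun t i ht1 ht2 hi hiK he => ?_
      · rw [diagPt_eq_iff]
        exact ⟨⟨-1, by ring⟩, 0, by ring⟩
      · have := hmeets he (by lia) (by lia) (by lia) (by lia)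
        lia)
  have : NeZero m := ⟨by lia⟩
  have : NeZero n := ⟨by lia⟩
  refine forall_reaches_of_shift (c := (1, 0)) (diagSegment m n (-1) (n + D))
    (fun x hx => successor_of_notMem (fun h => hx ?_) fun h => hx ?_) ?_ (fun x => ?_) x
  · obtain ⟨i, hi, rfl⟩ := h
    exact diagPt_mem_diagSegment (by have := hi.1; lia) hi.2
  · rw [h]
    exact diagPt_mem_diagSegment (by lia) (by lia)
  · rintro _ ⟨i, hi, rfl⟩
    rw [diagPt_add_fst]
    exact hall _ (by have := hi.1; lia) (by have := hi.2; lia)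
  · obtain ⟨j, t, hj, he⟩ := exists_sub_nsmul_fst x
    exact ⟨t, he ▸ diagPt_mem_diagSegment (by lia) (by lia)⟩

end NotDvd

theorem exists_disjoint_hamPaths_of_not_dvd {m n : ℕ} [NeZero m] [NeZero n] (hm : 2 ≤ m)
    (hmn : m ≤ n) (h : ¬ m ∣ n) :
    ∃ v v' : Fin (m * n) → ZMod m × ZMod n,
      IsHamPath ((1, 0) : ZMod m × ZMod n) ((0, 1) : ZMod m × ZMod n) (m * n) v ∧
      IsHamPath ((1, 0) : ZMod m × ZMod n) ((0, 1) : ZMod m × ZMod n) (m * n) v' ∧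
      Disjoint (ArcSet (m * n) v) (ArcSet (m * n) v') := by
  obtain ⟨q, w, hq, hw, hwm, hn⟩ : ∃ q w : ℕ, 1 ≤ q ∧ 0 < w ∧ w < m ∧ n = q * m + w :=
    ⟨n / m, n % m, (Nat.one_le_div_iff (by lia)).2 hmn,
      Nat.pos_of_ne_zero fun h0 => h (Nat.dvd_of_mod_eq_zero h0), Nat.mod_lt _ (by lia),
      (Nat.div_add_mod' n m).symm⟩
  obtain ⟨g, μ, Q', hg, hc, hμ, hQ⟩ := Nat.exists_coprime' (m := m - 1) (n := q + 1)
    (Nat.gcd_pos_of_pos_left _ (by lia))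
  have hmμ : m = g * μ + 1 := by rw [mul_comm]; lia
  have hμ0 : 0 < μ := by
    rcases Nat.eq_zero_or_pos μ with rfl | h
    · lia
    · exact h
  have hcop : Nat.Coprime μ (Q' * m) := by
    refine hc.mul_right ?_
    rw [hmμ]
    simp
  have hn' : (n : ℤ) = q * m + w := by exact_mod_cast hn
  set K : ℤ := (q + 1) * m + g - 2 with hK
  rw [mul_comm] at hQ
  have hgq : (g : ℤ) ≤ q + 1 := by exact_mod_cast Nat.le_of_dvd (by lia) ⟨Q', hQ⟩
  have hK0 : n ≤ K := by nlinarith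
  have hK1 : K ≤ 2 * n - 2 := by nlinarith
  obtain ⟨D, hD, hD0, hDn, hDK⟩ :
      ∃ D : ℤ, Odd D ∧ 1 ≤ D ∧ D < n ∧ (n + D = K ∨ n + D = K + 1) := by
    rcases Int.even_or_odd (K - n) with h | h
    · exact ⟨K - n + 1, h.add_one, by lia, by lia, by lia⟩
    · exact ⟨K - n, h, by obtain ⟨c, hc⟩ := h; lia, by lia, by lia⟩
  refine exists_disjoint_hamPaths (A := diagSegment m n 0 K) (A' := diagSegment m n 0 (n + D))
    (T := diagPt m n K 0) (T' := diagPt m n (-1) 0) (by simp) ?_ ?_ ?_ ?_ ?_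
    (reaches_of_rotation (by lia) (by lia) (by lia) hn' hg hμ0 hmμ (by exact_mod_cast hQ) hcop hK)
    (reaches_of_descent (by lia) (by lia) hn' hD hD0 hDn)
  · have : Fact (1 < m) := ⟨hm⟩
    simp
  · exact notMem_diagSegment (by lia) (by lia) hn' (by lia) (by lia) (by lia)
  · exact notMem_diagSegment (by lia) (by lia) hn' (by lia) (by lia) (by lia)
  · rintro _ ⟨i, hi, rfl⟩
    exact Or.inl (diagPt_mem_diagSegment hi.1 (by have := hi.2; lia))
  · rintro _ ⟨i, hi, rfl⟩
    rcases lt_or_ge i K with h | h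
    · exact Or.inl (diagPt_mem_diagSegment hi.1 h)
    · obtain rfl : i = K := by have := hi.2; lia
      exact Or.inr rfl

section Dvd

variable {m n : ℕ} {e k : ℤ}

theorem diagPt_eq_of_dvd (hmn : m ∣ n) {i j : ℤ} (t : ℤ) (h : (n : ℤ) ∣ i - j) :
    diagPt m n i t = diagPt m n j t := by
  rw [diagPt_eq_iff]
  refine ⟨(Int.natCast_dvd_natCast.2 hmn).trans (dvd_sub_comm.1 h), ?_⟩
  rwa [show t - j - (t - i) = i - j by ring]

theorem dvd_sub_of_diagPt_eq (hmn : m ∣ n) {i j t u : ℤ} (h : diagPt m n i t = diagPt m n j u) :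
    (m : ℤ) ∣ u - t := by
  rw [diagPt_eq_iff] at h
  have := dvd_add ((Int.natCast_dvd_natCast.2 hmn).trans h.2) h.1
  rwa [show u - j - (t - i) + (j - i) = u - t by ring] at this

theorem notMem_range_diagPt (hmn : m ∣ n) {t u : ℤ} (h0 : 0 < t - u) (h : t - u < m) (j : ℤ) :
    diagPt m n j t ∉ Set.range fun i => diagPt m n i u := by
  rintro ⟨i, hi⟩
  have := Int.le_of_dvd h0 (dvd_sub_of_diagPt_eq hmn hi)
  lia

theorem diagPt_zero_notMem_range (hmn : m ∣ n) (hm : 2 ≤ m) (j : ℤ) :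
    diagPt m n j 0 ∉ Set.range fun i => diagPt m n i 1 := by
  rintro ⟨i, hi⟩
  have := Int.le_of_dvd one_pos (dvd_sub_of_diagPt_eq hmn hi.symm)
  lia

theorem diagPt_notMem_diagSegment (hmn : m ∣ n) {t : ℤ} (h0 : 0 < t) (h : t < m) (j lo hi : ℤ) :
    diagPt m n j t ∉ diagSegment m n lo hi := by
  rintro ⟨i, -, hi⟩
  exact notMem_range_diagPt hmn (by simpa) (by simpa) j ⟨i, hi⟩

theorem diagPt_zero_notMem_diagSegment {lo hi j : ℤ} (h : hi ≤ j) (h' : j < lo + n) :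
    diagPt m n j 0 ∉ diagSegment m n lo hi := by
  rintro ⟨i, ⟨h1, h2⟩, hi⟩
  rw [diagPt_eq_iff] at hi
  have := eq_zero_of_dvd_of_lt hi.2 (by lia) (by lia)
  lia

/-- The union of the coset `t = 1` and a segment of the coset `t = 0`. -/
def cosetWithSegment (m n : ℕ) (lo hi : ℤ) : Set (ZMod m × ZMod n) :=
  (Set.range fun i => diagPt m n i 1) ∪ diagSegment m n lo hi

theorem diagPt_one_mem_cosetWithSegment (j lo hi : ℤ) :
    diagPt m n j 1 ∈ cosetWithSegment m n lo hi := Or.inl ⟨j, rfl⟩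

theorem diagPt_zero_mem_cosetWithSegment {lo hi j : ℤ} (h1 : lo ≤ j) (h2 : j < hi) :
    diagPt m n j 0 ∈ cosetWithSegment m n lo hi := Or.inr (diagPt_mem_diagSegment h1 h2)

theorem diagPt_notMem_cosetWithSegment (hmn : m ∣ n) {t : ℤ} (h0 : 2 ≤ t) (h : t < m)
    (j lo hi : ℤ) : diagPt m n j t ∉ cosetWithSegment m n lo hi := by
  rintro (h | h)
  · exact notMem_range_diagPt hmn (by lia) (by lia) j h
  · exact diagPt_notMem_diagSegment hmn (by lia) (by lia) _ _ _ h

theorem diagPt_zero_notMem_cosetWithSegment (hmn : m ∣ n) (hm : 2 ≤ m) {lo hi j : ℤ}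
    (h : hi ≤ j) (h' : j < lo + n) : diagPt m n j 0 ∉ cosetWithSegment m n lo hi := by
  rintro (h1 | h1)
  · exact diagPt_zero_notMem_range hmn hm j h1
  · exact diagPt_zero_notMem_diagSegment h h' h1

theorem diagPt_ne_diagPt_zero (hmn : m ∣ n) {t : ℤ} (h0 : 0 < t) (h : t < m) (i j : ℤ) :
    diagPt m n j t ≠ diagPt m n i 0 :=
  fun he => notMem_range_diagPt hmn (by simpa) (by simpa) j ⟨i, he.symm⟩

theorem diagPt_zero_ne {i j : ℤ} (h : j < i) (h' : i < j + n) :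
    diagPt m n i 0 ≠ diagPt m n j 0 := fun he =>
  diagPt_zero_notMem_diagSegment (m := m) (n := n) (lo := j) (hi := j + 1) h h'
    ⟨j, by simp, he.symm⟩

/-- From `diagPt m n j 1` the first path leads to `diagPt m n (j + 1 - m) 0`. -/
theorem reaches_coset_snd (hmn : m ∣ n) (hm : 2 ≤ m) {s : ZMod m × ZMod n} {j i : ℤ}
    (hr : Reaches (successor (1, 0) (0, 1) (cosetWithSegment m n 0 k) (diagPt m n k 0) s) s
      (diagPt m n j 1)) (hi : (n : ℤ) ∣ i - (j + 1 - m)) :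
    Reaches (successor (1, 0) (0, 1) (cosetWithSegment m n 0 k) (diagPt m n k 0) s) s
      (diagPt m n i 0) := by
  have h1 := hr.step
  rw [successor_of_mem (diagPt_one_mem_cosetWithSegment j _ _), diagPt_add_fst] at h1
  have h2 := Reaches.chain (fun t => diagPt m n (j + 1) t) (l := 2) (h := m) (by lia) h1
    fun t ht1 ht2 => by
      rw [successor_of_notMem (diagPt_notMem_cosetWithSegment hmn ht1 ht2 _ _ _)
        (diagPt_ne_diagPt_zero hmn (by lia) ht2 _ _), diagPt_add_snd]
  convert h2 using 1
  rw [diagPt_eq_of_dvd hmn 0 hi, diagPt_eq_iff]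
  exact ⟨⟨1, by ring⟩, 0, by ring⟩

/-- The first path: move by `e₁` from the coset `t = 1` and the segment, elsewhere by `e₂`. -/
theorem reaches_of_rotation_of_dvd {g μ L : ℕ} (hmn : m ∣ n) (hm : 2 ≤ m) (hn : 0 < n)
    (hg : 0 < g) (hμ : m = g * μ + 2) (hL : n = g * L) (hc : Nat.Coprime μ L)
    (hk : k = n - g) (x : ZMod m × ZMod n) :
    Reaches (successor (1, 0) (0, 1) (cosetWithSegment m n 0 k) (diagPt m n k 0) (diagPt m n 0 1))
      (diagPt m n 0 1) x := by
  set R : ℤ → Prop := fun j => Reaches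
    (successor (1, 0) (0, 1) (cosetWithSegment m n 0 k) (diagPt m n k 0) (diagPt m n 0 1))
    (diagPt m n 0 1) (diagPt m n j 1) with hR
  have hgn : g ≤ n := Nat.le_of_dvd hn ⟨L, hL⟩
  have hgL : (g * L : ℤ) = n := by exact_mod_cast hL.symm
  have hgμ : (g * μ : ℤ) = m - 2 := by rw [hμ]; push_cast; ring
  have hnext : ∀ i j : ℤ, 0 ≤ i → i < k → (n : ℤ) ∣ i - (j + 1 - m) → R j → R (i + 1) := by
    intro i j h1 h2 hd hj
    have := (reaches_coset_snd hmn hm hj hd).step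
    rwa [successor_of_mem (diagPt_zero_mem_cosetWithSegment h1 h2), diagPt_add_fst] at this
  have hskip : ∀ i j : ℤ, k < i → i < n → (n : ℤ) ∣ i - (j + 1 - m) → R j → R i := by
    intro i j h1 h2 hd hj
    have := (reaches_coset_snd hmn hm hj hd).step
    rwa [successor_of_notMem (diagPt_zero_notMem_cosetWithSegment hmn hm h1.le (by lia))
      (diagPt_zero_ne h1 (by lia)), diagPt_add_snd] at this
  have hμL : μ < L := by
    have := Nat.le_of_dvd hn hmn
    exact Nat.lt_of_mul_lt_mul_left (a := g) (by lia)
  have hper : ∀ i j : ℤ, (n : ℤ) ∣ i - j → R j → R i := fun i j h => by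
    rw [hR]; dsimp only; rw [diagPt_eq_of_dvd hmn 1 h]; exact id
  have hclass : ∀ ρ : ℕ, ρ < g → R (-ρ) → ∀ x < L, R (g * x - ρ) := by
    intro ρ hρ h0
    refine forall_of_rotation hμL hc (P := fun x => R (g * x - ρ)) (by simpa using h0)
      (fun x hx hP => ?_) (fun x hx hxL hP => ?_)
    · have h1 : (g * x + g : ℤ) ≤ g * μ := by nlinarith
      have h2 : (g * μ + g : ℤ) ≤ g * L := by nlinarith
      have h3 : (0 : ℤ) ≤ g * x := by positivity
      have := hnext (g * (x + L - μ) - ρ - 1) _ (by linarith) (by linarith)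
        ⟨1, by linear_combination hgL - hgμ⟩ hP
      rw [Nat.cast_sub (by lia)]
      push_cast
      convert this using 1
      ring
    · have h1 : (g * μ + g : ℤ) ≤ g * x := by nlinarith
      have h2 : (g * x + g : ℤ) ≤ g * L := by nlinarith
      have := hnext (g * (x - μ) - ρ - 1) _ (by linarith) (by linarith)
        ⟨0, by linear_combination - hgμ⟩ hP
      rw [Nat.cast_sub (by lia)]
      convert this using 1
      ring
  have hstart : ∀ ρ : ℕ, ρ < g → R (-ρ) := by
    intro ρ
    induction ρ with
    | zero => exact fun _ => .refl _ _
    | succ ρ ih =>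
      intro hρ
      have := hskip (n - ρ - 1) _ (by lia) (by lia) ⟨1, by linear_combination - hgμ⟩
        (hclass ρ (by lia) (ih (by lia)) μ hμL)
      exact hper _ _ ⟨-1, by push_cast; ring⟩ this
  have hall : ∀ j : ℤ, R j := by
    intro j
    have hg' : (0 : ℤ) < g := by lia
    have hρ := Int.emod_nonneg (-j) hg'.ne'
    have hρ' := Int.emod_lt_of_pos (-j) hg'
    have hL' : (0 : ℤ) < L := by lia
    have hx := Int.emod_nonneg (-(-j / g)) hL'.ne'
    have hx' := Int.emod_lt_of_pos (-(-j / g)) hL'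
    have := hclass (-j % g).toNat (by lia) (hstart _ (by lia)) (-(-j / g) % L).toNat (by lia)
    refine hper _ _ ⟨-(-j / g) / L, ?_⟩ this
    rw [Int.toNat_of_nonneg hρ, Int.toNat_of_nonneg hx]
    linear_combination Int.mul_ediv_add_emod (-j) g - g * Int.mul_ediv_add_emod (-(-j / g)) L +
      (-(-j / g) / L) * hgL
  have : NeZero m := ⟨by lia⟩
  have : NeZero n := ⟨by lia⟩
  refine forall_reaches_of_shift (c := (0, 1))
    ((Set.range fun i => diagPt m n i 1) ∪ Set.range fun i => diagPt m n i 0)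
    (fun x hx => successor_of_notMem (fun h => hx ?_) fun h => hx ?_) ?_ (fun x => ?_) x
  · exact h.imp_right fun ⟨i, _, hi⟩ => ⟨i, hi⟩
  · exact Or.inr ⟨k, h.symm⟩
  · rintro _ (⟨i, rfl⟩ | ⟨i, rfl⟩)
    · have := (hall (i - 1)).step
      rwa [successor_of_mem (diagPt_one_mem_cosetWithSegment _ _ _), diagPt_add_fst, sub_add_cancel,
        ← diagPt_add_snd] at this
    · dsimp only
      rw [diagPt_add_snd]
      exact hall i
  · obtain ⟨j, t, hj, he⟩ := exists_sub_nsmul_snd x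
    exact ⟨t, he ▸ Or.inr ⟨j, rfl⟩⟩

theorem forall_of_descent_of_even {R : ℤ → Prop} {n e k : ℤ} (hek : e ≤ k) (hev : Even (k - e))
    (hkn : k < n + e) (hper : R e → R (n + e)) (hk : R k)
    (h2 : ∀ j, e ≤ j → j < k → R (j + 2) → R j)
    (h1 : ∀ j, k ≤ j → j ≤ n + e - 2 → R (j + 2) → R (j + 1)) (j : ℤ) (hj : e ≤ j)
    (hjn : j < n + e) : R j := by
  obtain ⟨d, hd⟩ := hev
  have hdesc : ∀ (c : ℤ) (i : ℕ), e ≤ c - 2 * i → c ≤ k + 1 → R c → R (c - 2 * i) := by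
    intro c i
    induction i with
    | zero => intro _ _ h; simpa using h
    | succ i ih =>
      intro h3 h4 h
      refine h2 _ (by lia) (by lia) ?_
      convert ih (by lia) h4 h using 1
      lia
  have htop : ∀ i : ℕ, k + 1 ≤ n + e - i → R (n + e - i) := by
    intro i
    induction i with
    | zero =>
      intro _
      have := hdesc k d.toNat (by lia) (by lia) hk
      simpa using hper (by convert this using 1; lia)
    | succ i ih =>
      intro h3
      convert h1 (n + e - i - 2) (by lia) (by lia) (by convert ih (by lia) using 1; lia) using 1
      lia
  rcases lt_or_ge k j with h | h
  · convert htop (n + e - j).toNat (by lia) using 1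
    lia
  · rcases Int.even_or_odd' (k - j) with ⟨c, hc | hc⟩
    · convert hdesc k c.toNat (by lia) (by lia) hk using 1
      lia
    · have := htop (n + e - (k + 1)).toNat (by lia)
      convert hdesc (k + 1) (c + 1).toNat (by lia) (by lia) (by convert this using 1; lia) using 1
      lia

/-- From `diagPt m n j 1` the second path leads to `diagPt m n (j - 2) 0`. -/
theorem reaches_coset_fst (hmn : m ∣ n) (hm : 2 ≤ m) {s : ZMod m × ZMod n} {j i : ℤ}
    (hr : Reaches (successor (0, 1) (1, 0) (cosetWithSegment m n e k) (diagPt m n (e - 1) 0) s) s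
      (diagPt m n j 1)) (hi : i = j - 2) :
    Reaches (successor (0, 1) (1, 0) (cosetWithSegment m n e k) (diagPt m n (e - 1) 0) s) s
      (diagPt m n i 0) := by
  have h1 := hr.step
  rw [successor_of_mem (diagPt_one_mem_cosetWithSegment j _ _), diagPt_add_snd] at h1
  have h2 := Reaches.chain (fun t => diagPt m n (j + t - 2) t) (l := 2) (h := m) (by lia)
    (by simpa using h1)
    fun t ht1 ht2 => by
      rw [successor_of_notMem (diagPt_notMem_cosetWithSegment hmn ht1 ht2 _ _ _)
        (diagPt_ne_diagPt_zero hmn (by lia) ht2 _ _), diagPt_add_fst]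
      congr 1
      ring
  convert h2 using 1
  rw [hi, diagPt_eq_iff]
  exact ⟨⟨1, by ring⟩, 0, by ring⟩

/-- The second path: move by `e₂` from the coset `t = 1` and the segment, elsewhere by `e₁`. -/
theorem reaches_of_descent_of_dvd (hmn : m ∣ n) (hm : 2 ≤ m) (hek : e ≤ k) (hev : Even (k - e))
    (hkn : k < n + e) (x : ZMod m × ZMod n) :
    Reaches (successor (0, 1) (1, 0) (cosetWithSegment m n e k) (diagPt m n (e - 1) 0)
      (diagPt m n k 1)) (diagPt m n k 1) x := by
  have hn : (0 : ℤ) < n := by lia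
  set R : ℤ → Prop := fun j => Reaches (successor (0, 1) (1, 0) (cosetWithSegment m n e k)
    (diagPt m n (e - 1) 0) (diagPt m n k 1)) (diagPt m n k 1) (diagPt m n j 1) with hR
  have hper : ∀ i j : ℤ, (n : ℤ) ∣ i - j → R j → R i := fun i j h => by
    rw [hR]; dsimp only; rw [diagPt_eq_of_dvd hmn 1 h]; exact id
  have hwindow := forall_of_descent_of_even (R := R) hek hev hkn
    (hper _ _ ⟨1, by ring⟩) (.refl _ _)
    (fun j h1 h2 hj => by
      have := (reaches_coset_fst hmn hm hj (add_sub_cancel_right _ _).symm).step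
      rwa [successor_of_mem (diagPt_zero_mem_cosetWithSegment h1 h2), diagPt_add_snd] at this)
    (fun j h1 h2 hj => by
      have := (reaches_coset_fst hmn hm hj (add_sub_cancel_right _ _).symm).step
      rwa [successor_of_notMem (diagPt_zero_notMem_cosetWithSegment hmn hm h1 (by lia))
        (diagPt_zero_ne (by lia) (by lia)), diagPt_add_fst] at this)
  have hall : ∀ j, R j := fun j => by
    have h0 := Int.emod_nonneg (j - e) hn.ne'
    have h1 := Int.emod_lt_of_pos (j - e) hn
    exact hper _ _ ⟨(j - e) / n, by linear_combination - Int.mul_ediv_add_emod (j - e) n⟩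
      (hwindow (e + (j - e) % n) (by lia) (by lia))
  have : NeZero m := ⟨by lia⟩
  have : NeZero n := ⟨by lia⟩
  refine forall_reaches_of_shift (c := (1, 0))
    ((Set.range fun i => diagPt m n i 1) ∪ Set.range fun i => diagPt m n i 0)
    (fun x hx => successor_of_notMem (fun h => hx ?_) fun h => hx ?_) ?_ (fun x => ?_) x
  · exact h.imp_right fun ⟨i, _, hi⟩ => ⟨i, hi⟩
  · exact Or.inr ⟨_, h.symm⟩
  · rintro _ (⟨i, rfl⟩ | ⟨i, rfl⟩)
    · have := (hall (i + 1)).step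
      rwa [successor_of_mem (diagPt_one_mem_cosetWithSegment _ _ _), diagPt_add_snd,
        ← diagPt_add_fst] at this
    · dsimp only
      rw [diagPt_add_fst]
      exact hall _
  · obtain ⟨j, t, hj, he⟩ := exists_sub_nsmul_fst x
    exact ⟨t, he ▸ Or.inr ⟨j, rfl⟩⟩

end Dvd

theorem exists_disjoint_hamPaths_of_dvd {m n : ℕ} [NeZero m] [NeZero n] (hm : 2 ≤ m)
    (hmn : m ∣ n) :
    ∃ v v' : Fin (m * n) → ZMod m × ZMod n,
      IsHamPath ((1, 0) : ZMod m × ZMod n) ((0, 1) : ZMod m × ZMod n) (m * n) v ∧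
      IsHamPath ((1, 0) : ZMod m × ZMod n) ((0, 1) : ZMod m × ZMod n) (m * n) v' ∧
      Disjoint (ArcSet (m * n) v) (ArcSet (m * n) v') := by
  have hn := Nat.pos_of_neZero n
  obtain ⟨g, μ, L, hg, hc, hμ, hL⟩ := Nat.exists_coprime' (m := m - 2) (n := n)
    (Nat.gcd_pos_of_pos_right _ hn)
  rw [mul_comm] at hμ hL
  have hgn : g ≤ n := Nat.le_of_dvd hn ⟨L, hL⟩
  set k : ℤ := n - g with hk
  obtain ⟨e, he0, he1, hek, hev⟩ : ∃ e : ℤ, 0 ≤ e ∧ e ≤ 1 ∧ e ≤ k ∧ Even (k - e) := by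
    rcases Int.even_or_odd k with h | h
    · exact ⟨0, le_rfl, zero_le_one, by lia, by simpa⟩
    · exact ⟨1, zero_le_one, le_rfl, by obtain ⟨c, hc⟩ := h; lia, h.sub_odd odd_one⟩
  refine exists_disjoint_hamPaths (A := cosetWithSegment m n 0 k)
    (A' := cosetWithSegment m n e k) (T := diagPt m n k 0) (T' := diagPt m n (e - 1) 0) (by simp)
    ?_ ?_ ?_ ?_ ?_
    (reaches_of_rotation_of_dvd hmn hm hn hg (by lia) hL hc hk)
    (reaches_of_descent_of_dvd hmn hm hek hev (by lia))
  · have : Fact (1 < m) := ⟨hm⟩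
    simp
  · exact diagPt_zero_notMem_cosetWithSegment hmn hm le_rfl (by lia)
  · rw [diagPt_eq_of_dvd hmn 0 (i := e - 1) (j := e - 1 + n) ⟨-1, by ring⟩]
    exact diagPt_zero_notMem_cosetWithSegment hmn hm (by lia) (by lia)
  · rintro _ (h | ⟨i, hi, rfl⟩)
    · exact Or.inl (Or.inl h)
    · rcases lt_or_ge i e with h | h
      · obtain rfl : i = e - 1 := by have := hi.1; lia
        exact Or.inr rfl
      · exact Or.inl (diagPt_zero_mem_cosetWithSegment h hi.2)
  · rintro _ (h | ⟨i, hi, rfl⟩)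
    · exact Or.inl (Or.inl h)
    · exact Or.inl (diagPt_zero_mem_cosetWithSegment (by have := hi.1; lia) hi.2)

theorem exists_disjoint_hamPaths_of_le {m n : ℕ} [NeZero m] [NeZero n] (hm : 2 ≤ m)
    (hmn : m ≤ n) :
    ∃ v v' : Fin (m * n) → ZMod m × ZMod n,
      IsHamPath ((1, 0) : ZMod m × ZMod n) ((0, 1) : ZMod m × ZMod n) (m * n) v ∧
      IsHamPath ((1, 0) : ZMod m × ZMod n) ((0, 1) : ZMod m × ZMod n) (m * n) v' ∧
      Disjoint (ArcSet (m * n) v) (ArcSet (m * n) v') := by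
  by_cases h : m ∣ n
  · exact exists_disjoint_hamPaths_of_dvd hm h
  · exact exists_disjoint_hamPaths_of_not_dvd hm hmn h

theorem IsHamPath.map {G H : Type*} [AddCommGroup G] [AddCommGroup H] {N : ℕ} {a b : G}
    {v : Fin N → G} (h : IsHamPath a b N v) (f : G ≃+ H) :
    IsHamPath (f a) (f b) N (f ∘ v) := by
  refine ⟨f.bijective.comp h.1, fun i hi => ?_⟩
  rw [← Set.image_pair]
  exact ⟨_, h.2 i hi, map_sub f _ _⟩

theorem disjoint_arcSet_comp {G H : Type*} {N : ℕ} {v v' : Fin N → G}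
    (h : Disjoint (ArcSet N v) (ArcSet N v')) {f : G → H} (hf : Function.Injective f) :
    Disjoint (ArcSet N (f ∘ v)) (ArcSet N (f ∘ v')) := by
  rw [Set.disjoint_left] at h ⊢
  rintro _ ⟨i, hi, rfl⟩ ⟨j, hj, he⟩
  rw [Prod.mk.injEq] at he
  exact h ⟨i, hi, rfl⟩ ⟨j, hj, Prod.ext (hf he.1) (hf he.2)⟩

/-- The Cartesian product of two directed cycles of lengths `m, n ≥ 2`, i.e. the
Cayley digraph `Cay(ℤ_m × ℤ_n; e₁, e₂)`, has two arc-disjoint hamiltonian paths. -/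
theorem two_arc_disjoint_hamiltonian_paths_CmCn (m n : ℕ) (hm : 2 ≤ m) (hn : 2 ≤ n) :
    ∃ v v' : Fin (m * n) → ZMod m × ZMod n,
      IsHamPath ((1, 0) : ZMod m × ZMod n) ((0, 1) : ZMod m × ZMod n) (m * n) v ∧
      IsHamPath ((1, 0) : ZMod m × ZMod n) ((0, 1) : ZMod m × ZMod n) (m * n) v' ∧
      Disjoint (ArcSet (m * n) v) (ArcSet (m * n) v') := by
  have : NeZero m := ⟨by lia⟩
  have : NeZero n := ⟨by lia⟩
  rcases le_total m n with h | h
  · exact exists_disjoint_hamPaths_of_le hm h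
  · rw [mul_comm m n]
    obtain ⟨v, v', h1, h2, h3⟩ := exists_disjoint_hamPaths_of_le hn h
    exact ⟨_, _, (h1.map AddEquiv.prodComm).symm, (h2.map AddEquiv.prodComm).symm,
      disjoint_arcSet_comp h3 AddEquiv.prodComm.injective⟩
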